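/- Let d ≥ 1, θ ≥ 0 and β > 1, and write β = [β]⁻ + {β}⁺ with [β]⁻ a nonnegative integer and {β}⁺ ∈ (0,1]. Then there are constants N₁ = N₁(d, θ, β) > 0 and N₂ = N₂(d, θ, β) > 0 such that for every [β]⁻-times continuously differentiable function φ: ℝ^d → ℝ one has N₁ |r₁^{−θ}φ|_β ≤ |r₁^{−θ}φ|₀ + Σ_{|γ|=[β]⁻} |r₁^{−θ}∂^γφ|_{{β}⁺} ≤ N₂ |r₁^{−θ}φ|_β, where the sum ranges over multi-indices γ of length [β]⁻ and the inequalities are understood in [0,∞]. -/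

import Mathlib

open scoped ENNReal RealInnerProductSpace

noncomputable section

/-- `ℝ^d` with the Euclidean norm. -/
abbrev Euc (d : ℕ) : Type := EuclideanSpace ℝ (Fin d)

/-- The weight `r₁(x) = (1 + |x|²)^{1/2}`. -/
def r1 {d : ℕ} (x : Euc d) : ℝ := Real.sqrt (1 + ‖x‖ ^ 2)

/-- Sup-norm `|f|₀ = sup_x ‖f x‖`, valued in `[0,∞]`. -/
def nrm0 {d : ℕ} {V : Type*} [NormedAddCommGroup V] (f : Euc d → V) : ℝ≥0∞ :=
  ⨆ x, (‖f x‖₊ : ℝ≥0∞)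

/-- Hölder seminorm `[f]_β = sup_{x ≠ y} ‖f x - f y‖ / ‖x - y‖^β`, valued in `[0,∞]`. -/
def hsemi {d : ℕ} {V : Type*} [NormedAddCommGroup V] (β : ℝ) (f : Euc d → V) : ℝ≥0∞ :=
  ⨆ (x : Euc d) (y : Euc d) (_ : x ≠ y),
    (‖f x - f y‖₊ : ℝ≥0∞) / ENNReal.ofReal (‖x - y‖ ^ β)

/-- Partial derivative in the `i`-th coordinate direction. -/
def pder {d : ℕ} {V : Type*} [NormedAddCommGroup V] [NormedSpace ℝ V]
    (i : Fin d) (f : Euc d → V) : Euc d → V :=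
  fun x => fderiv ℝ f x (EuclideanSpace.single i 1)

/-- Iterated partial derivative in the `i`-th coordinate direction. -/
def pderPow {d : ℕ} {V : Type*} [NormedAddCommGroup V] [NormedSpace ℝ V]
    (i : Fin d) : ℕ → (Euc d → V) → Euc d → V
  | 0, f => f
  | n + 1, f => pder i (pderPow i n f)

/-- Multi-index partial derivative `∂^γ f = ∂_1^{γ 1} ⋯ ∂_d^{γ d} f`. -/
def mder {d : ℕ} {V : Type*} [NormedAddCommGroup V] [NormedSpace ℝ V]
    (γ : Fin d → ℕ) (f : Euc d → V) : Euc d → V :=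
  (List.finRange d).foldr (fun i g => pderPow i (γ i) g) f

/-- `[β]⁻`: for `β > 0`, the nonnegative integer with `β = [β]⁻ + {β}⁺`, `{β}⁺ ∈ (0,1]`. -/
def ifl (β : ℝ) : ℕ := ⌈β⌉₊ - 1

/-- `{β}⁺`: the fractional part in `(0,1]` of `β > 0`. -/
def frc (β : ℝ) : ℝ := β - (ifl β : ℝ)

/-- Hölder norm `|f|_β = Σ_{|γ| ≤ [β]⁻} |∂^γ f|₀ + Σ_{|γ| = [β]⁻} [∂^γ f]_{{β}⁺}`,
valued in `[0,∞]`. -/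
def holNorm {d : ℕ} {V : Type*} [NormedAddCommGroup V] [NormedSpace ℝ V]
    (β : ℝ) (f : Euc d → V) : ℝ≥0∞ :=
  (∑' γ : {γ : Fin d → ℕ // (∑ i, γ i) ≤ ifl β}, nrm0 (mder γ.1 f))
    + ∑' γ : {γ : Fin d → ℕ // (∑ i, γ i) = ifl β}, hsemi (frc β) (mder γ.1 f)

/-- `H̃(x) = x + H(x)`. -/
def tilde {d : ℕ} (H : Euc d → Euc d) : Euc d → Euc d := fun x => x + H x

/-- `H̃⁻¹`, the inverse map of `H̃`. -/
def tildeInv {d : ℕ} (H : Euc d → Euc d) : Euc d → Euc d := Function.invFun (tilde H)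

/-- `F(x) = H̃⁻¹(x) - x`, so that `H̃⁻¹(x) = x + F(x)`. -/
def Fof {d : ℕ} (H : Euc d → Euc d) : Euc d → Euc d := fun x => tildeInv H x - x

/-- The iterated partial derivative `∂_{i₁} ⋯ ∂_{iₖ} f` along the word `[i₁, …, iₖ]`. -/
def wordDeriv {d : ℕ} (L : List (Fin d)) (f : Euc d → ℝ) : Euc d → ℝ := L.foldr pder f

section WordDeriv

variable {d : ℕ}

@[simp] lemma wordDeriv_nil (f : Euc d → ℝ) : wordDeriv [] f = f := rfl

@[simp] lemma wordDeriv_cons (i : Fin d) (L : List (Fin d)) (f : Euc d → ℝ) :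
    wordDeriv (i :: L) f = pder i (wordDeriv L f) := rfl

lemma wordDeriv_append (L L' : List (Fin d)) (f : Euc d → ℝ) :
    wordDeriv (L ++ L') f = wordDeriv L (wordDeriv L' f) := List.foldr_append

lemma ContDiff.pder {f : Euc d → ℝ} {n : ℕ} (hf : ContDiff ℝ (n + 1 : ℕ) f) (i : Fin d) :
    ContDiff ℝ n (pder i f) :=
  (hf.fderiv_right (m := n) (by norm_cast)).clm_apply contDiff_const

lemma ContDiff.wordDeriv {f : Euc d → ℝ} (L : List (Fin d)) {n : ℕ}
    (hf : ContDiff ℝ (L.length + n : ℕ) f) : ContDiff ℝ n (wordDeriv L f) := by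
  induction L generalizing n with
  | nil => simpa using hf
  | cons i L ih =>
    refine ContDiff.pder (ih ?_) i
    convert hf using 2
    simp only [List.length_cons]
    ring

lemma ContDiff.wordDeriv_of_le {f : Euc d → ℝ} {L : List (Fin d)} {n m : ℕ}
    (hf : ContDiff ℝ m f) (h : L.length + n ≤ m) : ContDiff ℝ n (_root_.wordDeriv L f) :=
  ContDiff.wordDeriv L (hf.of_le (by exact_mod_cast h))

lemma pder_comm {f : Euc d → ℝ} (hf : ContDiff ℝ 2 f) (i j : Fin d) :
    pder i (pder j f) = pder j (pder i f) := by
  have key : ∀ (i j : Fin d) (x : Euc d), pder i (pder j f) x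
      = fderiv ℝ (fderiv ℝ f) x (EuclideanSpace.single i 1) (EuclideanSpace.single j 1) := by
    intro i j x
    have hd : DifferentiableAt ℝ (fderiv ℝ f) x :=
      (hf.fderiv_right (m := 1) (by norm_num)).differentiable (by norm_num) x
    change fderiv ℝ (fun y => fderiv ℝ f y (EuclideanSpace.single j 1)) x _ = _
    rw [fderiv_clm_apply hd (differentiableAt_const _)]
    simp
  funext x
  rw [key, key]
  exact (hf.contDiffAt.isSymmSndFDerivAt (by simp)) _ _

lemma wordDeriv_perm {L L' : List (Fin d)} (h : L.Perm L') {f : Euc d → ℝ}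
    (hf : ContDiff ℝ L.length f) : wordDeriv L f = wordDeriv L' f := by
  induction h with
  | nil => rfl
  | cons i _ ih =>
    rw [wordDeriv_cons, wordDeriv_cons, ih (hf.of_le (by simp))]
  | swap i j L =>
    exact pder_comm (ContDiff.wordDeriv_of_le (n := 2) hf (by simp)) _ _
  | trans h₁ _ ih₁ ih₂ => rw [ih₁ hf, ih₂ (by rwa [← h₁.length_eq])]

lemma pderPow_eq_wordDeriv (i : Fin d) (n : ℕ) (f : Euc d → ℝ) :
    pderPow i n f = wordDeriv (List.replicate n i) f := by
  induction n with
  | zero => rfl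
  | succ n ih => rw [List.replicate_succ, wordDeriv_cons, ← ih]; rfl

/-- The sorted word with `γ i` letters `i`. -/
def multiWord (γ : Fin d → ℕ) : List (Fin d) :=
  (List.finRange d).flatMap fun i => List.replicate (γ i) i

lemma mder_eq_wordDeriv (γ : Fin d → ℕ) (f : Euc d → ℝ) :
    mder γ f = wordDeriv (multiWord γ) f := by
  unfold mder multiWord
  induction List.finRange d with
  | nil => rfl
  | cons i l ih =>
    rw [List.foldr_cons, ih, List.flatMap_cons, wordDeriv_append, pderPow_eq_wordDeriv]

lemma length_multiWord (γ : Fin d → ℕ) : (multiWord γ).length = ∑ i, γ i := by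
  simp [multiWord, List.length_flatMap, Fin.sum_univ_def]

lemma count_multiWord (γ : Fin d → ℕ) (a : Fin d) : (multiWord γ).count a = γ a := by
  simp only [multiWord, List.count_flatMap, Function.comp_def, List.count_replicate]
  rw [← Fin.sum_univ_def]
  simp

lemma perm_multiWord_count (L : List (Fin d)) : L.Perm (multiWord fun i => L.count i) :=
  List.perm_iff_count.2 fun a => by rw [count_multiWord]

lemma wordDeriv_eq_mder {L : List (Fin d)} {f : Euc d → ℝ} (hf : ContDiff ℝ L.length f) :
    wordDeriv L f = mder (fun i => L.count i) f := by
  rw [mder_eq_wordDeriv, wordDeriv_perm (perm_multiWord_count L) hf]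

lemma sum_count_eq_length (L : List (Fin d)) : ∑ i, L.count i = L.length := by
  rw [← length_multiWord, ← (perm_multiWord_count L).length_eq]

end WordDeriv

section Interpolation

/-- Interpolation on `[0, 1]`: the first derivative is controlled by the function and its
`n`-th derivative. Here `h k` is the `k`-th derivative of `h 0`. -/
lemma exists_first_deriv_bound (n : ℕ) (hn : 1 ≤ n) :
    ∃ C : ℝ, 1 ≤ C ∧ ∀ (h : ℕ → ℝ → ℝ) (A B : ℝ),
      (∀ k < n, ∀ t, HasDerivAt (h k) (h (k + 1) t) t) →
      (∀ t ∈ Set.Icc (0 : ℝ) 1, |h 0 t| ≤ A) → (∀ t ∈ Set.Icc (0 : ℝ) 1, |h n t| ≤ B) →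
      ∀ t ∈ Set.Icc (0 : ℝ) 1, |h 1 t| ≤ C * (A + B) := by
  induction n, hn using Nat.le_induction with
  | base =>
    refine ⟨1, le_rfl, fun h A B _ hA hB t ht => ?_⟩
    have := (abs_nonneg _).trans (hA t ht)
    linarith [hB t ht]
  | succ n hn ih =>
    obtain ⟨C, hC, ih⟩ := ih
    refine ⟨16 * C, by linarith, fun h A B hd hA hB t ht => ?_⟩
    have hcont : ContinuousOn (fun t => |h 1 t|) (Set.Icc 0 1) := fun t _ =>
      (hd 1 (by omega) t).continuousAt.abs.continuousWithinAt
    obtain ⟨t₀, ht₀, hmax⟩ := isCompact_Icc.exists_isMaxOn ⟨t, ht⟩ hcont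
    have hS : ∀ t ∈ Set.Icc (0 : ℝ) 1, |h 1 t| ≤ |h 1 t₀| := fun t ht => hmax ht
    refine (hS t ht).trans ?_
    set S := |h 1 t₀|
    have h2 : ∀ t ∈ Set.Icc (0 : ℝ) 1, |h 2 t| ≤ C * (S + B) :=
      ih (fun k => h (k + 1)) S B (fun k hk => hd (k + 1) (by omega)) hS hB
    have hA0 : 0 ≤ A := (abs_nonneg _).trans (hA t ht)
    have hB0 : 0 ≤ B := (abs_nonneg _).trans (hB t ht)
    have hS0 : 0 ≤ S := abs_nonneg _
    set ε := 1 / (4 * C) with hε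
    have hε0 : 0 < ε := by positivity
    have hε1 : ε ≤ 1 / 2 := by
      rw [hε]; exact one_div_le_one_div_of_le (by norm_num) (by linarith)
    have hεC : ε * C = 1 / 4 := by rw [hε]; field_simp
    obtain ⟨t₁, ht₁, hdist⟩ : ∃ t₁ ∈ Set.Icc (0 : ℝ) 1, |t₁ - t₀| = ε := by
      rcases le_total t₀ (1 / 2) with h' | h'
      · exact ⟨t₀ + ε, ⟨by linarith [ht₀.1], by linarith⟩, by simp [abs_of_pos hε0]⟩
      · exact ⟨t₀ - ε, ⟨by linarith, by linarith [ht₀.2]⟩, by simp [abs_of_pos hε0]⟩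
    have hsub : Set.uIcc t₀ t₁ ⊆ Set.Icc 0 1 := Set.uIcc_subset_Icc ht₀ ht₁
    have h1 : ∀ t ∈ Set.uIcc t₀ t₁, |h 1 t - h 1 t₀| ≤ C * (S + B) * ε := by
      intro t ht'
      have := (convex_Icc (0 : ℝ) 1).norm_image_sub_le_of_norm_hasDerivWithin_le
        (fun t _ => (hd 1 (by omega) t).hasDerivWithinAt) h2 ht₀ (hsub ht')
      refine this.trans (mul_le_mul_of_nonneg_left ?_ (by positivity))
      rw [← hdist]
      exact Set.abs_sub_left_of_mem_uIcc ht'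
    have h0 : |(h 0 t₁ - h 1 t₀ * t₁) - (h 0 t₀ - h 1 t₀ * t₀)| ≤ C * (S + B) * ε * |t₁ - t₀| := by
      refine (convex_uIcc t₀ t₁).norm_image_sub_le_of_norm_hasDerivWithin_le
        (f := fun t => h 0 t - h 1 t₀ * t) (f' := fun t => h 1 t - h 1 t₀)
        (fun t _ => ?_) h1 Set.left_mem_uIcc Set.right_mem_uIcc
      have := (hd 0 (by omega) t).fun_sub ((hasDerivAt_id t).const_mul (h 1 t₀))
      simpa using this.hasDerivWithinAt
    have hprod : S * ε ≤ 2 * A + C * (S + B) * ε * ε := by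
      rw [hdist] at h0
      have e1 : S * ε = |h 1 t₀ * (t₁ - t₀)| := by rw [abs_mul, hdist]
      rw [e1]
      have ha := abs_le.1 (hA t₀ ht₀)
      have hb := abs_le.1 (hA t₁ ht₁)
      have hc := abs_le.1 h0
      rw [abs_le]
      constructor <;> linarith
    have h3 : S * (ε * C) ≤ 2 * A * C + (S + B) * (ε * C) * (ε * C) := by
      have := mul_le_mul_of_nonneg_right hprod (by linarith : (0 : ℝ) ≤ C)
      linarith
    rw [hεC] at h3
    nlinarith [mul_nonneg hB0 (by linarith : (0 : ℝ) ≤ C - 1)]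

end Interpolation

section Weight

variable {d : ℕ}

lemma one_le_r1 (x : Euc d) : 1 ≤ r1 x := by
  rw [r1, Real.one_le_sqrt]
  nlinarith [sq_nonneg ‖x‖]

lemma r1_pos (x : Euc d) : 0 < r1 x := one_pos.trans_le (one_le_r1 x)

lemma r1_sq (x : Euc d) : r1 x ^ 2 = 1 + ‖x‖ ^ 2 := Real.sq_sqrt (by positivity)

lemma norm_le_r1 (x : Euc d) : ‖x‖ ≤ r1 x := by
  nlinarith [r1_sq x, r1_pos x, norm_nonneg x]

lemma r1_add_le {x v : Euc d} (hv : ‖v‖ ≤ 1) : r1 (x + v) ≤ 2 * r1 x := by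
  have h := norm_add_le x v
  have hx := norm_le_r1 x
  have h1 := one_le_r1 x
  refine Real.sqrt_le_iff.2 ⟨by linarith, ?_⟩
  have h2 : ‖x + v‖ ^ 2 ≤ (‖x‖ + 1) ^ 2 := by
    have := norm_nonneg (x + v)
    gcongr
    linarith
  nlinarith [r1_sq x, sq_nonneg (‖x‖ - 1)]

lemma r1_rpow_eq (p : ℝ) (x : Euc d) : r1 x ^ p = (1 + ‖x‖ ^ 2) ^ (p / 2) := by
  rw [r1, Real.sqrt_eq_rpow, ← Real.rpow_mul (by positivity)]
  ring_nf

lemma contDiff_r1_rpow (p : ℝ) (n : ℕ) : ContDiff ℝ n fun x : Euc d => r1 x ^ p := by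
  simp only [r1_rpow_eq]
  exact (contDiff_const.add (contDiff_norm_sq ℝ)).rpow_const_of_ne fun x => by positivity

lemma pder_r1_rpow (p : ℝ) (i : Fin d) (x : Euc d) :
    pder i (fun y : Euc d => r1 y ^ p) x
      = r1 x ^ p * (p * (x i * (r1 x)⁻¹ * (r1 x)⁻¹)) := by
  have h : HasFDerivAt (fun y : Euc d => 1 + ‖y‖ ^ 2) (2 • innerSL ℝ x) x :=
    (hasStrictFDerivAt_norm_sq x).hasFDerivAt.const_add 1
  have h' := h.rpow_const (p := p / 2) (Or.inl (by positivity))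
  have hr := r1_pos x
  have e : r1 x ^ p = (1 + ‖x‖ ^ 2) ^ (p / 2 - 1) * r1 x ^ 2 := by
    rw [r1_rpow_eq, Real.rpow_sub_one (by positivity), r1_sq]
    field_simp
  rw [e]
  simp only [pder, r1_rpow_eq]
  rw [h'.fderiv]
  simp [EuclideanSpace.inner_single_right]
  field_simp

lemma pder_fun_mul {f g : Euc d → ℝ} (hf : Differentiable ℝ f) (hg : Differentiable ℝ g)
    (i : Fin d) (x : Euc d) :
    pder i (fun y => f y * g y) x = pder i f x * g x + f x * pder i g x := by
  simp only [pder]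
  rw [fderiv_fun_mul (hf x) (hg x)]
  simp
  ring

lemma pder_fun_add {f g : Euc d → ℝ} (hf : Differentiable ℝ f) (hg : Differentiable ℝ g)
    (i : Fin d) (x : Euc d) :
    pder i (fun y => f y + g y) x = pder i f x + pder i g x := by
  simp only [pder]
  rw [fderiv_fun_add (hf x) (hg x)]
  simp

lemma pder_r1_rpow_mul {f : Euc d → ℝ} (hf : Differentiable ℝ f) (p : ℝ) (i : Fin d)
    (x : Euc d) :
    pder i (fun y => r1 y ^ p * f y) x
      = r1 x ^ p * (p * (x i * (r1 x)⁻¹ * (r1 x)⁻¹) * f x + pder i f x) := by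
  rw [pder_fun_mul ((contDiff_r1_rpow p 1).differentiable (by simp)) hf, pder_r1_rpow]
  ring

lemma abs_sub_le_of_pder_le {f : Euc d → ℝ} (hf : Differentiable ℝ f) {K : ℝ} (hK : 0 ≤ K)
    (h : ∀ i x, |pder i f x| ≤ K) (x y : Euc d) : |f x - f y| ≤ d * K * ‖x - y‖ := by
  refine Convex.norm_image_sub_le_of_norm_fderiv_le (𝕜 := ℝ) (s := Set.univ)
    (fun z _ => hf z) (fun z _ => ?_) convex_univ (Set.mem_univ y) (Set.mem_univ x)
  refine ContinuousLinearMap.opNorm_le_bound _ (by positivity) fun v => ?_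
  have hv : v = ∑ i, v i • (EuclideanSpace.single i 1 : Euc d) := by
    conv_lhs => rw [← (EuclideanSpace.basisFun (Fin d) ℝ).sum_repr v]
    simp
  conv_lhs => rw [hv]
  rw [map_sum]
  calc ‖∑ i, fderiv ℝ f z (v i • EuclideanSpace.single i 1)‖
      ≤ ∑ _i : Fin d, K * ‖v‖ := norm_sum_le_of_le _ fun i _ => by
        rw [map_smul, norm_smul, mul_comm]
        exact mul_le_mul (h i z) (PiLp.norm_apply_le v i) (norm_nonneg _) hK
    _ = d * K * ‖v‖ := by simp [mul_assoc]

lemma holder_of_bounded_of_lipschitz {f : Euc d → ℝ} {s K K' : ℝ} (hs : 0 < s) (hs1 : s ≤ 1)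
    (hK' : 0 ≤ K') (hf : ∀ x, |f x| ≤ K) (hf' : ∀ x y, |f x - f y| ≤ K' * ‖x - y‖)
    (x y : Euc d) : |f x - f y| ≤ (2 * K + K') * ‖x - y‖ ^ s := by
  have hK : 0 ≤ K := (abs_nonneg _).trans (hf x)
  have hn := norm_nonneg (x - y)
  have hns := Real.rpow_nonneg hn s
  rcases le_total ‖x - y‖ 1 with h | h
  · have h1 : ‖x - y‖ ≤ ‖x - y‖ ^ s := by
      simpa using Real.rpow_le_rpow_of_exponent_ge_of_imp hn h hs1 (fun _ h0 => absurd h0 one_ne_zero)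
    have := hf' x y
    have := mul_le_mul_of_nonneg_left h1 hK'
    nlinarith
  · have h1 : 1 ≤ ‖x - y‖ ^ s := Real.one_le_rpow h hs.le
    have := abs_sub (f x) (f y)
    nlinarith [hf x, hf y]

lemma holder_mul {f g : Euc d → ℝ} {s A A' B B' : ℝ} (hf : ∀ x, |f x| ≤ A)
    (hf' : ∀ x y, |f x - f y| ≤ A' * ‖x - y‖ ^ s) (hg : ∀ x, |g x| ≤ B)
    (hg' : ∀ x y, |g x - g y| ≤ B' * ‖x - y‖ ^ s) (x y : Euc d) :
    |f x * g x - f y * g y| ≤ (A * B' + A' * B) * ‖x - y‖ ^ s := by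
  have e : f x * g x - f y * g y = f x * (g x - g y) + (f x - f y) * g y := by ring
  rw [e]
  refine (abs_add_le _ _).trans ?_
  rw [abs_mul, abs_mul]
  have h1 := mul_le_mul (hf x) (hg' x y) (abs_nonneg _) ((abs_nonneg _).trans (hf x))
  have h2 := mul_le_mul (hf' x y) (hg y) (abs_nonneg _) ((abs_nonneg _).trans (hf' x y))
  linarith

end Weight

section SymbolOp

variable {d : ℕ}

/-- The algebra of functions generated by `1 / r₁` and the `xᵢ / r₁`: it is stable under partial
derivatives and consists of bounded functions. -/
inductive BddSymbol : (Euc d → ℝ) → Prop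
  | const (c : ℝ) : BddSymbol fun _ => c
  | inv : BddSymbol fun x => (r1 x)⁻¹
  | coord (i : Fin d) : BddSymbol fun x => x i * (r1 x)⁻¹
  | add {f g : Euc d → ℝ} : BddSymbol f → BddSymbol g → BddSymbol fun x => f x + g x
  | mul {f g : Euc d → ℝ} : BddSymbol f → BddSymbol g → BddSymbol fun x => f x * g x

lemma contDiff_inv_r1 (n : ℕ) : ContDiff ℝ n fun x : Euc d => (r1 x)⁻¹ := by
  simpa only [Real.rpow_neg_one] using contDiff_r1_rpow (d := d) (-1) n

lemma contDiff_coord (i : Fin d) (n : ℕ) : ContDiff ℝ n fun x : Euc d => x i :=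
  (EuclideanSpace.proj (𝕜 := ℝ) i : Euc d →L[ℝ] ℝ).contDiff

lemma BddSymbol.contDiff {a : Euc d → ℝ} (ha : BddSymbol a) (n : ℕ) : ContDiff ℝ n a := by
  induction ha with
  | const c => exact contDiff_const
  | inv => exact contDiff_inv_r1 n
  | coord i => exact (contDiff_coord i n).mul (contDiff_inv_r1 n)
  | add _ _ hf hg => exact hf.add hg
  | mul _ _ hf hg => exact hf.mul hg

lemma BddSymbol.differentiable {a : Euc d → ℝ} (ha : BddSymbol a) : Differentiable ℝ a :=
  (ha.contDiff 1).differentiable (by simp)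

lemma BddSymbol.exists_bound {a : Euc d → ℝ} (ha : BddSymbol a) : ∃ C, ∀ x, |a x| ≤ C := by
  induction ha with
  | const c => exact ⟨|c|, fun _ => le_rfl⟩
  | inv =>
    exact ⟨1, fun x => by
      rw [abs_of_pos (inv_pos.2 (r1_pos x))]; exact inv_le_one_of_one_le₀ (one_le_r1 x)⟩
  | coord i =>
    refine ⟨1, fun x => ?_⟩
    rw [abs_mul, abs_of_pos (inv_pos.2 (r1_pos x)), ← div_eq_mul_inv, div_le_one (r1_pos x)]
    exact (PiLp.norm_apply_le x i).trans (norm_le_r1 x)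
  | add _ _ hf hg =>
    obtain ⟨A, hA⟩ := hf
    obtain ⟨B, hB⟩ := hg
    exact ⟨A + B, fun x => (abs_add_le _ _).trans (add_le_add (hA x) (hB x))⟩
  | mul _ _ hf hg =>
    obtain ⟨A, hA⟩ := hf
    obtain ⟨B, hB⟩ := hg
    refine ⟨A * B, fun x => ?_⟩
    rw [abs_mul]
    exact mul_le_mul (hA x) (hB x) (abs_nonneg _) ((abs_nonneg _).trans (hA x))

lemma pder_inv_r1 (i : Fin d) (x : Euc d) :
    pder i (fun y : Euc d => (r1 y)⁻¹) x
      = (r1 x)⁻¹ * (-1 * (x i * (r1 x)⁻¹ * (r1 x)⁻¹)) := by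
  have := pder_r1_rpow (-1) i x
  simpa only [Real.rpow_neg_one] using this

lemma pder_coord (i j : Fin d) (x : Euc d) :
    pder i (fun y : Euc d => y j) x = if j = i then 1 else 0 := by
  have h : HasFDerivAt (fun y : Euc d => y j) (EuclideanSpace.proj (𝕜 := ℝ) j : Euc d →L[ℝ] ℝ) x :=
    (EuclideanSpace.proj (𝕜 := ℝ) j : Euc d →L[ℝ] ℝ).hasFDerivAt
  simp [pder, h.fderiv]

lemma BddSymbol.pder {a : Euc d → ℝ} (ha : BddSymbol a) (i : Fin d) : BddSymbol (pder i a) := by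
  induction ha with
  | const c =>
    convert BddSymbol.const (d := d) 0 using 1
    funext x
    simp [_root_.pder]
  | inv =>
    rw [show _root_.pder i (fun y : Euc d => (r1 y)⁻¹) = _ from funext (pder_inv_r1 i)]
    exact .mul .inv (.mul (.const _) (.mul (.coord i) .inv))
  | coord j =>
    convert BddSymbol.add (.mul (.const (if j = i then 1 else 0)) .inv)
      (.mul (.coord j) (.mul (.const (-1)) (.mul (.coord i) .inv))) using 1
    funext x
    rw [pder_fun_mul ((contDiff_coord j 1).differentiable (by simp))
      ((contDiff_inv_r1 1).differentiable (by simp)), pder_coord, pder_inv_r1]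
    ring
  | add hf hg ihf ihg =>
    convert BddSymbol.add ihf ihg using 1
    exact funext (pder_fun_add hf.differentiable hg.differentiable i)
  | mul hf hg ihf ihg =>
    convert BddSymbol.add (.mul ihf hg) (.mul hf ihg) using 1
    exact funext (pder_fun_mul hf.differentiable hg.differentiable i)

lemma BddSymbol.exists_holder {a : Euc d → ℝ} (ha : BddSymbol a) {s : ℝ} (hs : 0 < s)
    (hs1 : s ≤ 1) : ∃ C, ∀ x y, |a x - a y| ≤ C * ‖x - y‖ ^ s := by
  obtain ⟨A, hA⟩ := ha.exists_bound
  choose B hB using fun i => (ha.pder i).exists_bound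
  have hB0 : ∀ i, 0 ≤ B i := fun i => (abs_nonneg _).trans (hB i 0)
  have hS : 0 ≤ ∑ i, B i := Finset.sum_nonneg fun i _ => hB0 i
  exact ⟨_, holder_of_bounded_of_lipschitz hs hs1 (by positivity) hA
    (abs_sub_le_of_pder_le ha.differentiable hS fun i x =>
      (hB i x).trans (Finset.single_le_sum (fun i _ => hB0 i) (Finset.mem_univ i)))⟩

/-- Differential operators of order at most `k` with coefficients in `BddSymbol`. -/
inductive SymbolOp (k : ℕ) : ((Euc d → ℝ) → Euc d → ℝ) → Prop
  | term {a : Euc d → ℝ} {L : List (Fin d)} : BddSymbol a → L.length ≤ k →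
      SymbolOp k fun φ x => a x * wordDeriv L φ x
  | add {T T' : (Euc d → ℝ) → Euc d → ℝ} : SymbolOp k T → SymbolOp k T' →
      SymbolOp k fun φ x => T φ x + T' φ x

lemma SymbolOp.contDiff {k n : ℕ} {T : (Euc d → ℝ) → Euc d → ℝ} (hT : SymbolOp k T)
    {φ : Euc d → ℝ} (hφ : ContDiff ℝ (k + n : ℕ) φ) : ContDiff ℝ n (T φ) := by
  induction hT with
  | term ha hL => exact (ha.contDiff n).mul (ContDiff.wordDeriv_of_le hφ (by omega))
  | add _ _ ih ih' => exact ih.add ih'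

lemma SymbolOp.exists_pder {k : ℕ} {T : (Euc d → ℝ) → Euc d → ℝ} (hT : SymbolOp k T)
    (q : ℝ) (i : Fin d) : ∃ T', SymbolOp (k + 1) T' ∧ ∀ φ, ContDiff ℝ (k + 1 : ℕ) φ → ∀ x,
      pder i (fun y => r1 y ^ q * T φ y) x = r1 x ^ q * T' φ x := by
  induction hT with
  | @term a L ha hL =>
    refine ⟨_, .add (.term (L := L) (.add (.mul (.mul (.const q) (.mul (.coord i) .inv)) ha)
      (ha.pder i)) (by omega)) (.term (L := i :: L) ha (by simpa using hL)), fun φ hφ x => ?_⟩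
    have hd : Differentiable ℝ (wordDeriv L φ) :=
      (ContDiff.wordDeriv_of_le (n := 1) hφ (by omega)).differentiable (by simp)
    rw [pder_r1_rpow_mul (ha.differentiable.fun_mul hd), pder_fun_mul ha.differentiable hd]
    simp only [wordDeriv_cons]
    ring
  | @add T₁ T₂ h₁ h₂ ih₁ ih₂ =>
    obtain ⟨S₁, hS₁, e₁⟩ := ih₁
    obtain ⟨S₂, hS₂, e₂⟩ := ih₂
    refine ⟨_, .add hS₁ hS₂, fun φ hφ x => ?_⟩
    have hw : Differentiable ℝ fun x : Euc d => r1 x ^ q :=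
      (contDiff_r1_rpow q 1).differentiable (by simp)
    have hd₁ : Differentiable ℝ (T₁ φ) := (h₁.contDiff (n := 1) hφ).differentiable (by simp)
    have hd₂ : Differentiable ℝ (T₂ φ) := (h₂.contDiff (n := 1) hφ).differentiable (by simp)
    simp only [mul_add]
    rw [pder_fun_add (hw.fun_mul hd₁) (hw.fun_mul hd₂), e₁ φ hφ, e₂ φ hφ]

/-- Leibniz rule for a product with a power of `r₁`. -/
lemma exists_symbolOp_wordDeriv_r1_rpow_mul (q : ℝ) (L : List (Fin d)) :
    ∃ T, SymbolOp L.length T ∧ ∀ φ : Euc d → ℝ, ContDiff ℝ L.length φ →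
      wordDeriv L (fun x => r1 x ^ q * φ x) = fun x => r1 x ^ q * T φ x := by
  induction L with
  | nil => exact ⟨_, .term (L := []) (.const 1) le_rfl, fun φ _ => by simp⟩
  | cons i L ih =>
    obtain ⟨T, hT, e⟩ := ih
    obtain ⟨T', hT', e'⟩ := hT.exists_pder q i
    refine ⟨T', hT', fun φ hφ => ?_⟩
    rw [wordDeriv_cons, e φ (hφ.of_le (by simp))]
    exact funext (e' φ hφ)

end SymbolOp

section WeightedBound

variable {d : ℕ}

/-- `M` bounds the weighted derivatives `r₁^p ∂^L φ` of order at most `m`, and the `s`-Hölder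
seminorms of those of order `m`. -/
structure WeightedBound (p s : ℝ) (m : ℕ) (φ : Euc d → ℝ) (M : ℝ) : Prop where
  sup_le : ∀ L : List (Fin d), L.length ≤ m → ∀ x, |r1 x ^ p * wordDeriv L φ x| ≤ M
  holder_le : ∀ L : List (Fin d), L.length = m → ∀ x y,
    |r1 x ^ p * wordDeriv L φ x - r1 y ^ p * wordDeriv L φ y| ≤ M * ‖x - y‖ ^ s

lemma WeightedBound.nonneg {p s M : ℝ} {m : ℕ} {φ : Euc d → ℝ}
    (h : WeightedBound p s m φ M) : 0 ≤ M :=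
  (abs_nonneg _).trans (h.sup_le [] (by simp) 0)

lemma exists_holder_bound_of_weightedBound (d : ℕ) (p : ℝ) {s : ℝ} (hs : 0 < s) (hs1 : s ≤ 1)
    (m : ℕ) : ∃ C : ℝ, 1 ≤ C ∧ ∀ (φ : Euc d → ℝ) (M : ℝ), ContDiff ℝ m φ →
      WeightedBound p s m φ M → ∀ L : List (Fin d), L.length ≤ m → ∀ x y,
        |r1 x ^ p * wordDeriv L φ x - r1 y ^ p * wordDeriv L φ y| ≤ C * M * ‖x - y‖ ^ s := by
  have hb : ∀ i : Fin d, BddSymbol fun x : Euc d => p * (x i * (r1 x)⁻¹ * (r1 x)⁻¹) :=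
    fun i => .mul (.const p) (.mul (.coord i) .inv)
  choose B hB using fun i => (hb i).exists_bound
  have hB0 : ∀ i, 0 ≤ B i := fun i => (abs_nonneg _).trans (hB i 0)
  set K := ∑ i, B i
  have hK0 : 0 ≤ K := Finset.sum_nonneg fun i _ => hB0 i
  have hBK : ∀ i, B i ≤ K := fun i =>
    Finset.single_le_sum (fun i _ => hB0 i) (Finset.mem_univ i)
  have hdK : 0 ≤ d * (K + 1) := by positivity
  refine ⟨2 + d * (K + 1), by linarith, fun φ M hφ h L hL x y => ?_⟩
  have hM := h.nonneg
  rcases hL.eq_or_lt with hL | hL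
  · refine (h.holder_le L hL x y).trans ?_
    have := Real.rpow_nonneg (norm_nonneg (x - y)) s
    gcongr
    nlinarith
  · have hw : Differentiable ℝ fun x : Euc d => r1 x ^ p :=
      (contDiff_r1_rpow p 1).differentiable (by simp)
    have hd : Differentiable ℝ (wordDeriv L φ) :=
      (ContDiff.wordDeriv_of_le (n := 1) hφ (by omega)).differentiable (by simp)
    have hgrad : ∀ i x, |pder i (fun y => r1 y ^ p * wordDeriv L φ y) x| ≤ (K + 1) * M := by
      intro i x
      rw [pder_r1_rpow_mul hd, mul_add, mul_left_comm, add_mul, one_mul]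
      refine (abs_add_le _ _).trans (add_le_add ?_ (h.sup_le (i :: L) (by simpa using hL) x))
      rw [abs_mul]
      exact mul_le_mul ((hB i x).trans (hBK i)) (h.sup_le L hL.le x) (abs_nonneg _) hK0
    refine (holder_of_bounded_of_lipschitz hs hs1 (by positivity) (h.sup_le L hL.le)
      (abs_sub_le_of_pder_le (hw.fun_mul hd) (by positivity) hgrad) x y).trans_eq ?_
    ring

lemma SymbolOp.exists_bound {k m : ℕ} {T : (Euc d → ℝ) → Euc d → ℝ} (hT : SymbolOp k T)
    (hk : k ≤ m) (p : ℝ) {s : ℝ} (hs : 0 < s) (hs1 : s ≤ 1) :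
    ∃ C : ℝ, 0 ≤ C ∧ ∀ (φ : Euc d → ℝ) (M : ℝ), ContDiff ℝ m φ → WeightedBound p s m φ M →
      (∀ x, |r1 x ^ p * T φ x| ≤ C * M) ∧
      ∀ x y, |r1 x ^ p * T φ x - r1 y ^ p * T φ y| ≤ C * M * ‖x - y‖ ^ s := by
  induction hT with
  | @term a L ha hL =>
    obtain ⟨A, hA⟩ := ha.exists_bound
    obtain ⟨A', hA'⟩ := ha.exists_holder hs hs1
    obtain ⟨C, hC, hhol⟩ := exists_holder_bound_of_weightedBound d p hs hs1 m
    have hA0 : 0 ≤ A := (abs_nonneg _).trans (hA 0)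
    refine ⟨A * C + |A'|, by positivity, fun φ M hφ h => ?_⟩
    have hM := h.nonneg
    have hsup := h.sup_le L (hL.trans hk)
    constructor
    · intro x
      rw [mul_left_comm, abs_mul]
      refine (mul_le_mul (hA x) (hsup x) (abs_nonneg _) hA0).trans ?_
      gcongr
      nlinarith [abs_nonneg A']
    · intro x y
      rw [mul_left_comm, mul_left_comm (r1 y ^ p)]
      refine (holder_mul hA hA' hsup (hhol φ M hφ h L (hL.trans hk)) x y).trans ?_
      have := Real.rpow_nonneg (norm_nonneg (x - y)) s
      gcongr
      nlinarith [le_abs_self A']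
  | add _ _ ih₁ ih₂ =>
    obtain ⟨C₁, h₁, b₁⟩ := ih₁
    obtain ⟨C₂, h₂, b₂⟩ := ih₂
    refine ⟨C₁ + C₂, add_nonneg h₁ h₂, fun φ M hφ h => ⟨fun x => ?_, fun x y => ?_⟩⟩
    · rw [mul_add, add_mul]
      exact (abs_add_le _ _).trans (add_le_add ((b₁ φ M hφ h).1 x) ((b₂ φ M hφ h).1 x))
    · rw [mul_add, mul_add, add_mul, add_mul, add_sub_add_comm]
      exact (abs_add_le _ _).trans (add_le_add ((b₁ φ M hφ h).2 x y) ((b₂ φ M hφ h).2 x y))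

lemma finite_length_le (d m : ℕ) : Finite {L : List (Fin d) // L.length ≤ m} :=
  (List.finite_length_le (Fin d) m).to_subtype

/-- Moving a power of `r₁` from the weight into the function. -/
lemma exists_weightedBound_r1_rpow_mul (d : ℕ) (p q : ℝ) {s : ℝ} (hs : 0 < s) (hs1 : s ≤ 1)
    (m : ℕ) : ∃ C : ℝ, 0 ≤ C ∧ ∀ (φ : Euc d → ℝ) (M : ℝ), ContDiff ℝ m φ →
      WeightedBound (p + q) s m φ M → WeightedBound p s m (fun x => r1 x ^ q * φ x) (C * M) := by
  have := finite_length_le d m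
  have := Fintype.ofFinite {L : List (Fin d) // L.length ≤ m}
  choose T hT hTe using exists_symbolOp_wordDeriv_r1_rpow_mul (d := d) q
  choose C hC hCb using fun L : {L : List (Fin d) // L.length ≤ m} =>
    (hT L.1).exists_bound L.2 (p + q) hs hs1
  have hle : ∀ L, C L ≤ ∑ L, C L := fun L =>
    Finset.single_le_sum (fun i _ => hC i) (Finset.mem_univ L)
  refine ⟨∑ L, C L, Finset.sum_nonneg fun L _ => hC L, fun φ M hφ h => ?_⟩
  have hM := h.nonneg
  have e : ∀ L : List (Fin d), L.length ≤ m → ∀ x,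
      r1 x ^ p * wordDeriv L (fun x => r1 x ^ q * φ x) x = r1 x ^ (p + q) * T L φ x := by
    intro L hL x
    rw [hTe L φ (hφ.of_le (by exact_mod_cast hL)), Real.rpow_add (r1_pos x), mul_assoc]
  constructor
  · intro L hL x
    rw [e L hL]
    exact ((hCb ⟨L, hL⟩ φ M hφ h).1 x).trans (mul_le_mul_of_nonneg_right (hle _) hM)
  · intro L hL x y
    rw [e L hL.le, e L hL.le]
    refine ((hCb ⟨L, hL.le⟩ φ M hφ h).2 x y).trans ?_
    have := Real.rpow_nonneg (norm_nonneg (x - y)) s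
    have := hle ⟨L, hL.le⟩
    gcongr

lemma hasDerivAt_pderPow {n k : ℕ} {f : Euc d → ℝ} (hf : ContDiff ℝ n f) (hk : k < n)
    (i : Fin d) (x : Euc d) (t : ℝ) :
    HasDerivAt (fun t : ℝ => pderPow i k f (x + t • EuclideanSpace.single i 1))
      (pderPow i (k + 1) f (x + t • EuclideanSpace.single i 1)) t := by
  have hd : DifferentiableAt ℝ (pderPow i k f) (x + t • EuclideanSpace.single i 1) := by
    rw [pderPow_eq_wordDeriv]
    exact (ContDiff.wordDeriv_of_le (n := 1) hf (by simpa using hk)).differentiable (by simp) _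
  have hline : HasDerivAt (fun t : ℝ => x + t • (EuclideanSpace.single i 1 : Euc d))
      (EuclideanSpace.single i 1) t := by
    simpa using ((hasDerivAt_id t).smul_const (EuclideanSpace.single i 1 : Euc d)).const_add x
  exact hd.hasFDerivAt.comp_hasDerivAt t hline

/-- Weighted interpolation for one partial derivative. -/
lemma exists_weighted_pder_bound (d : ℕ) {θ : ℝ} (hθ : 0 ≤ θ) (n : ℕ) (hn : 1 ≤ n) :
    ∃ C : ℝ, 1 ≤ C ∧ ∀ (f : Euc d → ℝ) (i : Fin d) (M : ℝ), ContDiff ℝ n f →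
      (∀ x, |r1 x ^ (-θ) * f x| ≤ M) → (∀ x, |r1 x ^ (-θ) * pderPow i n f x| ≤ M) →
      ∀ x, |r1 x ^ (-θ) * pder i f x| ≤ C * M := by
  obtain ⟨C, hC, hb⟩ := exists_first_deriv_bound n hn
  have h2 : (1 : ℝ) ≤ 2 ^ θ := Real.one_le_rpow (by norm_num) hθ
  refine ⟨C * (2 * 2 ^ θ), by nlinarith, fun f i M hf h0 hn' x => ?_⟩
  have hM : 0 ≤ M := (abs_nonneg _).trans (h0 x)
  have hx := r1_pos x
  have key : ∀ g : Euc d → ℝ, (∀ x, |r1 x ^ (-θ) * g x| ≤ M) → ∀ t ∈ Set.Icc (0 : ℝ) 1,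
      |g (x + t • EuclideanSpace.single i 1)| ≤ 2 ^ θ * r1 x ^ θ * M := by
    intro g hg t ht
    set y := x + t • (EuclideanSpace.single i 1 : Euc d)
    have hyx : r1 y ≤ 2 * r1 x := r1_add_le (by
      rw [norm_smul]; simpa [abs_of_nonneg ht.1] using ht.2)
    have hgy := hg y
    have hypos := r1_pos y
    rw [abs_mul, abs_of_pos (Real.rpow_pos_of_pos hypos _), Real.rpow_neg hypos.le,
      inv_mul_le_iff₀ (Real.rpow_pos_of_pos hypos _)] at hgy
    refine hgy.trans (mul_le_mul_of_nonneg_right ?_ hM)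
    rw [← Real.mul_rpow (by norm_num) hx.le]
    exact Real.rpow_le_rpow hypos.le hyx hθ
  have h1 := hb (fun k t => pderPow i k f (x + t • EuclideanSpace.single i 1)) _ _
    (fun k hk t => hasDerivAt_pderPow hf hk i x t) (key f h0) (key _ hn') 0 (by simp)
  simp only [zero_smul, add_zero] at h1
  rw [abs_mul, abs_of_pos (Real.rpow_pos_of_pos hx _), Real.rpow_neg hx.le,
    inv_mul_le_iff₀ (Real.rpow_pos_of_pos hx _)]
  refine h1.trans_eq ?_
  ring

/-- Weighted interpolation: the function and its derivatives of order `m` control the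
intermediate derivatives. -/
lemma exists_weighted_wordDeriv_bound (d : ℕ) {θ : ℝ} (hθ : 0 ≤ θ) (m k : ℕ) (hk : k ≤ m) :
    ∃ C : ℝ, 1 ≤ C ∧ ∀ (φ : Euc d → ℝ) (M : ℝ), ContDiff ℝ m φ →
      (∀ x, |r1 x ^ (-θ) * φ x| ≤ M) →
      (∀ L : List (Fin d), L.length = m → ∀ x, |r1 x ^ (-θ) * wordDeriv L φ x| ≤ M) →
      ∀ L : List (Fin d), L.length = k → ∀ x, |r1 x ^ (-θ) * wordDeriv L φ x| ≤ C * M := by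
  induction k with
  | zero =>
    refine ⟨1, le_rfl, fun φ M _ h0 _ L hL x => ?_⟩
    rw [List.length_eq_zero_iff.1 hL, one_mul]
    exact h0 x
  | succ k ih =>
    obtain ⟨C, hC, ih⟩ := ih (by omega)
    obtain ⟨C', hC', hb⟩ := exists_weighted_pder_bound d hθ (m - k) (by omega)
    refine ⟨C' * C, by nlinarith, fun φ M hφ h0 hm L hL x => ?_⟩
    have hM : 0 ≤ M := (abs_nonneg _).trans (h0 x)
    obtain ⟨i, L, rfl⟩ := List.exists_cons_of_length_eq_add_one hL
    have hL : L.length = k := by simpa using hL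
    rw [mul_assoc]
    refine hb (wordDeriv L φ) i (C * M) (ContDiff.wordDeriv_of_le hφ (by omega))
      (ih φ M hφ h0 hm L hL) (fun y => ?_) x
    rw [pderPow_eq_wordDeriv, ← wordDeriv_append]
    refine (hm _ ?_ y).trans (le_mul_of_one_le_left hM hC)
    simp only [List.length_append, List.length_replicate]
    omega

lemma exists_weightedBound_of_top (d : ℕ) {θ : ℝ} (hθ : 0 ≤ θ) (s : ℝ) (m : ℕ) :
    ∃ C : ℝ, 0 ≤ C ∧ ∀ (φ : Euc d → ℝ) (M : ℝ), ContDiff ℝ m φ →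
      (∀ x, |r1 x ^ (-θ) * φ x| ≤ M) →
      (∀ L : List (Fin d), L.length = m → ∀ x, |r1 x ^ (-θ) * wordDeriv L φ x| ≤ M) →
      (∀ L : List (Fin d), L.length = m → ∀ x y,
        |r1 x ^ (-θ) * wordDeriv L φ x - r1 y ^ (-θ) * wordDeriv L φ y| ≤ M * ‖x - y‖ ^ s) →
      WeightedBound (-θ) s m φ (C * M) := by
  choose C hC hb using fun k : Fin (m + 1) =>
    exists_weighted_wordDeriv_bound d hθ m k (Nat.lt_succ_iff.1 k.2)
  have hle : ∀ k, C k ≤ ∑ k, C k := fun k =>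
    Finset.single_le_sum (fun i _ => zero_le_one.trans (hC i)) (Finset.mem_univ k)
  have h1 : 1 ≤ ∑ k, C k := (hC 0).trans (hle 0)
  refine ⟨∑ k, C k, by linarith, fun φ M hφ h0 hm hh => ⟨fun L hL x => ?_, fun L hL x y => ?_⟩⟩
  · have hM : 0 ≤ M := (abs_nonneg _).trans (h0 x)
    exact (hb ⟨L.length, by omega⟩ φ M hφ h0 hm L rfl x).trans
      (mul_le_mul_of_nonneg_right (hle _) hM)
  · have hM : 0 ≤ M := (abs_nonneg _).trans (h0 x)
    refine (hh L hL x y).trans ?_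
    have := Real.rpow_nonneg (norm_nonneg (x - y)) s
    gcongr
    exact le_mul_of_one_le_left hM h1

end WeightedBound

section NormBounds

variable {d : ℕ}

lemma nrm0_le_ofReal_iff {f : Euc d → ℝ} {M : ℝ} (hM : 0 ≤ M) :
    nrm0 f ≤ ENNReal.ofReal M ↔ ∀ x, |f x| ≤ M := by
  simp only [nrm0, iSup_le_iff]
  refine forall_congr' fun x => ?_
  rw [← enorm_eq_nnnorm, ← ofReal_norm, ENNReal.ofReal_le_ofReal_iff hM,
    Real.norm_eq_abs]

lemma hsemi_le_ofReal_iff {f : Euc d → ℝ} {s M : ℝ} (hs : 0 < s) (hM : 0 ≤ M) :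
    hsemi s f ≤ ENNReal.ofReal M ↔ ∀ x y, |f x - f y| ≤ M * ‖x - y‖ ^ s := by
  simp only [hsemi, iSup_le_iff]
  refine forall_congr' fun x => forall_congr' fun y => ?_
  rcases eq_or_ne x y with rfl | hxy
  · simp [Real.zero_rpow hs.ne']
  have hpos : 0 < ‖x - y‖ ^ s := Real.rpow_pos_of_pos (norm_pos_iff.2 (sub_ne_zero.2 hxy)) s
  rw [← enorm_eq_nnnorm, ← ofReal_norm, ← ENNReal.ofReal_div_of_pos hpos,
    ENNReal.ofReal_le_ofReal_iff hM, Real.norm_eq_abs, div_le_iff₀ hpos]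
  exact ⟨fun h => h hxy, fun h _ => h⟩

lemma finite_multiIndex_le (d m : ℕ) : Finite {γ : Fin d → ℕ // (∑ i, γ i) ≤ m} :=
  ((Set.finite_Iic (fun _ : Fin d => m)).subset fun γ (hγ : ∑ i, γ i ≤ m) i =>
    (Finset.single_le_sum (fun i _ => Nat.zero_le (γ i)) (Finset.mem_univ i)).trans hγ).to_subtype

lemma finite_multiIndex_eq (d m : ℕ) : Finite {γ : Fin d → ℕ // (∑ i, γ i) = m} :=
  have := finite_multiIndex_le d m
  Finite.of_injective _ (Subtype.impEmbedding _ (fun γ : Fin d → ℕ => ∑ i, γ i ≤ m)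
    fun _ h => h.le).injective

lemma tsum_le_card_mul_ofReal {ι : Type*} [Finite ι] {f : ι → ℝ≥0∞} {M : ℝ}
    (h : ∀ i, f i ≤ ENNReal.ofReal M) : ∑' i, f i ≤ ENNReal.ofReal (Nat.card ι * M) := by
  have := Fintype.ofFinite ι
  rw [tsum_fintype, ENNReal.ofReal_mul (by positivity), ENNReal.ofReal_natCast,
    Nat.card_eq_fintype_card]
  exact (Finset.sum_le_sum fun i _ => h i).trans (by simp)

/-- The reduced weighted norm `|r₁^{-θ} φ|₀ + ∑_{|γ| = m} |r₁^{-θ} ∂^γ φ|_s`. -/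
def reducedNorm (θ s : ℝ) (m : ℕ) (φ : Euc d → ℝ) : ℝ≥0∞ :=
  nrm0 (fun x => r1 x ^ (-θ) * φ x)
    + ∑' γ : {γ : Fin d → ℕ // (∑ i, γ i) = m},
        (nrm0 (fun x => r1 x ^ (-θ) * mder γ.1 φ x)
          + hsemi s (fun x => r1 x ^ (-θ) * mder γ.1 φ x))

lemma exists_reducedNorm_le (d : ℕ) (θ : ℝ) {s : ℝ} (hs : 0 < s) (m : ℕ) :
    ∃ C : ℝ, 0 ≤ C ∧ ∀ (φ : Euc d → ℝ) (M : ℝ), WeightedBound (-θ) s m φ M →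
      reducedNorm θ s m φ ≤ ENNReal.ofReal (C * M) := by
  have := finite_multiIndex_eq d m
  refine ⟨1 + Nat.card {γ : Fin d → ℕ // (∑ i, γ i) = m} * 2, by positivity, fun φ M h => ?_⟩
  have hM := h.nonneg
  rw [add_mul, one_mul, mul_assoc, ENNReal.ofReal_add hM (by positivity)]
  refine add_le_add ((nrm0_le_ofReal_iff hM).2 (h.sup_le [] (by simp)))
    (tsum_le_card_mul_ofReal fun γ => ?_)
  have hlen := (length_multiWord γ.1).trans γ.2
  rw [two_mul, ENNReal.ofReal_add hM hM, mder_eq_wordDeriv]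
  exact add_le_add ((nrm0_le_ofReal_iff hM).2 (h.sup_le _ hlen.le))
    ((hsemi_le_ofReal_iff hs hM).2 (h.holder_le _ hlen))

lemma exists_weightedBound_of_reducedNorm (d : ℕ) {θ : ℝ} (hθ : 0 ≤ θ) {s : ℝ} (hs : 0 < s)
    (m : ℕ) : ∃ C : ℝ, 0 ≤ C ∧ ∀ (φ : Euc d → ℝ) (M : ℝ), 0 ≤ M → ContDiff ℝ m φ →
      reducedNorm θ s m φ ≤ ENNReal.ofReal M → WeightedBound (-θ) s m φ (C * M) := by
  obtain ⟨C, hC, hb⟩ := exists_weightedBound_of_top d hθ s m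
  refine ⟨C, hC, fun φ M hM hφ h => ?_⟩
  have hterm : ∀ L : List (Fin d), L.length = m →
      nrm0 (fun x => r1 x ^ (-θ) * wordDeriv L φ x)
        + hsemi s (fun x => r1 x ^ (-θ) * wordDeriv L φ x) ≤ ENNReal.ofReal M := by
    intro L hL
    rw [wordDeriv_eq_mder (by rwa [hL])]
    exact ((ENNReal.le_tsum (f := fun γ : {γ : Fin d → ℕ // (∑ i, γ i) = m} =>
      nrm0 (fun x => r1 x ^ (-θ) * mder γ.1 φ x)
        + hsemi s (fun x => r1 x ^ (-θ) * mder γ.1 φ x))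
      ⟨_, (sum_count_eq_length L).trans hL⟩).trans le_add_self).trans h
  exact hb φ M hφ ((nrm0_le_ofReal_iff hM).1 (le_self_add.trans h))
    (fun L hL => (nrm0_le_ofReal_iff hM).1 (le_self_add.trans (hterm L hL)))
    (fun L hL => (hsemi_le_ofReal_iff hs hM).1 (le_add_self.trans (hterm L hL)))

lemma exists_holNorm_le (d : ℕ) {β : ℝ} (hs : 0 < frc β) :
    ∃ C : ℝ, 0 ≤ C ∧ ∀ (g : Euc d → ℝ) (M : ℝ), WeightedBound 0 (frc β) (ifl β) g M →
      holNorm β g ≤ ENNReal.ofReal (C * M) := by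
  have := finite_multiIndex_eq d (ifl β)
  have := finite_multiIndex_le d (ifl β)
  refine ⟨Nat.card {γ : Fin d → ℕ // (∑ i, γ i) ≤ ifl β}
    + Nat.card {γ : Fin d → ℕ // (∑ i, γ i) = ifl β}, by positivity, fun g M h => ?_⟩
  have hM := h.nonneg
  rw [add_mul, ENNReal.ofReal_add (by positivity) (by positivity)]
  refine add_le_add (tsum_le_card_mul_ofReal fun γ => ?_) (tsum_le_card_mul_ofReal fun γ => ?_)
  · rw [mder_eq_wordDeriv, nrm0_le_ofReal_iff hM]
    simpa using h.sup_le _ ((length_multiWord γ.1).trans_le γ.2)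
  · rw [mder_eq_wordDeriv, hsemi_le_ofReal_iff hs hM]
    simpa using h.holder_le _ ((length_multiWord γ.1).trans γ.2)

lemma weightedBound_of_holNorm_le {β : ℝ} (hs : 0 < frc β) {g : Euc d → ℝ} {M : ℝ}
    (hM : 0 ≤ M) (hg : ContDiff ℝ (ifl β) g) (h : holNorm β g ≤ ENNReal.ofReal M) :
    WeightedBound 0 (frc β) (ifl β) g M := by
  constructor
  · intro L hL
    simp only [Real.rpow_zero, one_mul]
    rw [wordDeriv_eq_mder (hg.of_le (by exact_mod_cast hL)), ← nrm0_le_ofReal_iff hM]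
    exact ((ENNReal.le_tsum (f := fun γ : {γ : Fin d → ℕ // (∑ i, γ i) ≤ ifl β} =>
      nrm0 (mder γ.1 g)) ⟨_, (sum_count_eq_length L).trans_le hL⟩).trans le_self_add).trans h
  · intro L hL
    simp only [Real.rpow_zero, one_mul]
    rw [wordDeriv_eq_mder (by rwa [hL]), ← hsemi_le_ofReal_iff hs hM]
    exact ((ENNReal.le_tsum (f := fun γ : {γ : Fin d → ℕ // (∑ i, γ i) = ifl β} =>
      hsemi (frc β) (mder γ.1 g)) ⟨_, (sum_count_eq_length L).trans hL⟩).trans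
        le_add_self).trans h

lemma frc_pos {β : ℝ} (hβ : 0 < β) : 0 < frc β := by
  have h1 : 1 ≤ ⌈β⌉₊ := Nat.one_le_ceil_iff.2 hβ
  have h2 := Nat.ceil_lt_add_one hβ.le
  rw [frc, ifl, Nat.cast_sub h1]
  push_cast
  linarith

lemma frc_le_one {β : ℝ} (hβ : 0 < β) : frc β ≤ 1 := by
  have h1 : 1 ≤ ⌈β⌉₊ := Nat.one_le_ceil_iff.2 hβ
  have h2 := Nat.le_ceil β
  rw [frc, ifl, Nat.cast_sub h1]
  push_cast
  linarith

lemma exists_holNorm_le_reducedNorm (d : ℕ) {θ β : ℝ} (hθ : 0 ≤ θ) (hβ : 0 < β) :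
    ∃ C : ℝ, 0 ≤ C ∧ ∀ φ : Euc d → ℝ, ContDiff ℝ (ifl β) φ → ∀ M : ℝ, 0 ≤ M →
      reducedNorm θ (frc β) (ifl β) φ ≤ ENNReal.ofReal M →
        holNorm β (fun x => r1 x ^ (-θ) * φ x) ≤ ENNReal.ofReal (C * M) := by
  have hs := frc_pos hβ
  obtain ⟨C₁, h₁, b₁⟩ := exists_weightedBound_of_reducedNorm d hθ hs (ifl β)
  obtain ⟨C₂, h₂, b₂⟩ := exists_weightedBound_r1_rpow_mul d 0 (-θ) hs (frc_le_one hβ) (ifl β)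
  obtain ⟨C₃, h₃, b₃⟩ := exists_holNorm_le d hs
  refine ⟨C₃ * (C₂ * C₁), by positivity, fun φ hφ M hM h => ?_⟩
  rw [mul_assoc, mul_assoc]
  refine b₃ _ _ (b₂ φ _ hφ ?_)
  rw [zero_add]
  exact b₁ φ M hM hφ h

lemma exists_reducedNorm_le_holNorm (d : ℕ) (θ : ℝ) {β : ℝ} (hβ : 0 < β) :
    ∃ C : ℝ, 0 ≤ C ∧ ∀ φ : Euc d → ℝ, ContDiff ℝ (ifl β) φ → ∀ M : ℝ, 0 ≤ M →
      holNorm β (fun x => r1 x ^ (-θ) * φ x) ≤ ENNReal.ofReal M →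
        reducedNorm θ (frc β) (ifl β) φ ≤ ENNReal.ofReal (C * M) := by
  have hs := frc_pos hβ
  obtain ⟨C₁, h₁, b₁⟩ := exists_weightedBound_r1_rpow_mul d (-θ) θ hs (frc_le_one hβ) (ifl β)
  obtain ⟨C₂, h₂, b₂⟩ := exists_reducedNorm_le d θ hs (ifl β)
  refine ⟨C₂ * C₁, by positivity, fun φ hφ M hM h => ?_⟩
  have hg := (contDiff_r1_rpow (d := d) (-θ) (ifl β)).mul hφ
  have hb := b₁ _ M hg (by simpa using weightedBound_of_holNorm_le hs hM hg h)
  have e : (fun x => r1 x ^ θ * (r1 x ^ (-θ) * φ x)) = φ := by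
    funext x
    rw [← mul_assoc, ← Real.rpow_add (r1_pos x)]
    simp
  rw [mul_assoc]
  refine b₂ φ _ ?_
  rw [← e]
  exact hb

lemma le_ofReal_mul_of_forall {X Y : ℝ≥0∞} {C N : ℝ} (hN : 0 < N) (hCN : C ≤ N)
    (h : ∀ M : ℝ, 0 ≤ M → Y ≤ ENNReal.ofReal M → X ≤ ENNReal.ofReal (C * M)) :
    X ≤ ENNReal.ofReal N * Y := by
  rcases eq_or_ne Y ∞ with rfl | hY
  · rw [ENNReal.mul_top (by simpa using hN)]
    exact le_top
  · refine (h Y.toReal ENNReal.toReal_nonneg (ENNReal.ofReal_toReal hY).ge).trans ?_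
    rw [← ENNReal.ofReal_toReal hY, ← ENNReal.ofReal_mul hN.le,
      ENNReal.toReal_ofReal ENNReal.toReal_nonneg]
    exact ENNReal.ofReal_le_ofReal (mul_le_mul_of_nonneg_right hCN ENNReal.toReal_nonneg)

end NormBounds

/-- equivalence of weighted Hölder norms, reduced sum version. -/
theorem stmt_6 (d : ℕ) (hd : 1 ≤ d) (θ β : ℝ) (hθ : 0 ≤ θ) (hβ : 1 < β) :
    ∃ N₁ N₂ : ℝ, 0 < N₁ ∧ 0 < N₂ ∧
      ∀ φ : Euc d → ℝ, ContDiff ℝ (ifl β : ℕ) φ →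
        (ENNReal.ofReal N₁ * holNorm β (fun x => r1 x ^ (-θ) * φ x) ≤
            nrm0 (fun x => r1 x ^ (-θ) * φ x)
              + ∑' γ : {γ : Fin d → ℕ // (∑ i, γ i) = ifl β},
                  (nrm0 (fun x => r1 x ^ (-θ) * mder γ.1 φ x)
                    + hsemi (frc β) (fun x => r1 x ^ (-θ) * mder γ.1 φ x)))
        ∧ (nrm0 (fun x => r1 x ^ (-θ) * φ x)
              + ∑' γ : {γ : Fin d → ℕ // (∑ i, γ i) = ifl β},
                  (nrm0 (fun x => r1 x ^ (-θ) * mder γ.1 φ x)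
                    + hsemi (frc β) (fun x => r1 x ^ (-θ) * mder γ.1 φ x))) ≤
            ENNReal.ofReal N₂ * holNorm β (fun x => r1 x ^ (-θ) * φ x) := by
  have hβ' : 0 < β := one_pos.trans hβ
  obtain ⟨C₁, h₁, b₁⟩ := exists_holNorm_le_reducedNorm d hθ hβ'
  obtain ⟨C₂, h₂, b₂⟩ := exists_reducedNorm_le_holNorm d θ hβ'
  have hN₁ : 0 < C₁ + 1 := by linarith
  have hN₂ : 0 < C₂ + 1 := by linarith
  refine ⟨(C₁ + 1)⁻¹, C₂ + 1, inv_pos.2 hN₁, hN₂, fun φ hφ =>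
    ⟨?_, le_ofReal_mul_of_forall hN₂ (by linarith) (b₂ φ hφ)⟩⟩
  change _ ≤ reducedNorm θ (frc β) (ifl β) φ
  have h := le_ofReal_mul_of_forall hN₁ (by linarith) (b₁ φ hφ)
  calc _ ≤ ENNReal.ofReal (C₁ + 1)⁻¹ *
        (ENNReal.ofReal (C₁ + 1) * reducedNorm θ (frc β) (ifl β) φ) := by gcongr
    _ = _ := by
      rw [← mul_assoc, ← ENNReal.ofReal_mul (by positivity), inv_mul_cancel₀ hN₁.ne']
      simp
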